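/- arXiv:2406.16662 — 4 statements merged into one kernel-verified Lean document; each statement's English description precedes it below -/
import Mathlib

section
/- Let 𝒳1, 𝒳2, 𝒴1, 𝒴2 be finite fields (only their additive group structure is used) and 𝒵 a finite set. Let X_1, X_2, Y_1, Y_2, Z be random variables such that X_1 and X_2 are independent, and such that Y_1, Y_2, Z are mutually conditionally independent given (X_1,X_2) (conditionally independent channel). Let Y_1′ be uniformly distributed on 𝒴1 and (X_2′,Y_2′) be uniformly distributed on 𝒳2×𝒴2, with Y_1′, (X_2′,Y_2′) and (X_1,X_2,Y_1,Y_2,Z) mutually independent. Set X_1′ := 0 (so X_1″ := X_1 ⊕ X_1′ = X_1), Y_1″ := Y_1 ⊕ Y_1′, X_2″ := X_2 ⊕ X_2′, Y_2″ := Y_2 ⊕ Y_2′, and let V_1 := Y_1′ and V_2 := 0 (a constant). Then I(V_1 ; (X_2,Y_2,X_1″,Y_1″) | (X_2′,Y_2′)) − I((V_1,V_2) ; (Z,X_1″,Y_1″,X_2″,Y_2″)) = I(Y_1 ; X_2 | X_1) − I(Y_1 ; Z | X_1), and I(V_2 ; (X_1,Y_1,X_2″,Y_2″) | (X_1′,Y_1′))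 = 0. -/
open Finset

set_option synthInstance.maxSize 1000

noncomputable section

/-- Distribution (PMF) of a random variable `X` on a finite probability space `(Ω, μ)`. -/
def dist' {Ω A : Type*} [Fintype Ω] [DecidableEq A] (μ : Ω → ℝ) (X : Ω → A) (a : A) : ℝ :=
  ∑ ω, if X ω = a then μ ω else 0

/-- Shannon entropy (natural logarithm) of a random variable `X` on `(Ω, μ)`. -/
def entropy' {Ω A : Type*} [Fintype Ω] [Fintype A] [DecidableEq A]
    (μ : Ω → ℝ) (X : Ω → A) : ℝ :=
  -∑ a, dist' μ X a * Real.log (dist' μ X a)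

/-- Shannon mutual information `I(X;Y)` (natural logarithm). -/
def mi {Ω A B : Type*} [Fintype Ω] [Fintype A] [Fintype B] [DecidableEq A] [DecidableEq B]
    (μ : Ω → ℝ) (X : Ω → A) (Y : Ω → B) : ℝ :=
  entropy' μ X + entropy' μ Y - entropy' μ (fun ω => (X ω, Y ω))

/-- Shannon conditional mutual information `I(X;Y|C)` (natural logarithm),
via `I(X;Y|C) = H(X,C) + H(Y,C) − H(X,Y,C) − H(C)`. -/
def cmi {Ω A B C : Type*} [Fintype Ω] [Fintype A] [Fintype B] [Fintype C]
    [DecidableEq A] [DecidableEq B] [DecidableEq C]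
    (μ : Ω → ℝ) (X : Ω → A) (Y : Ω → B) (C' : Ω → C) : ℝ :=
  entropy' μ (fun ω => (X ω, C' ω)) + entropy' μ (fun ω => (Y ω, C' ω)) -
    entropy' μ (fun ω => (X ω, Y ω, C' ω)) - entropy' μ C'

/-- A sum over `ω` of `μ ω` times a function of `X ω` is a sum against the distribution of `X`. -/
lemma sum_dist'_mul {Ω A : Type*} [Fintype Ω] [Fintype A] [DecidableEq A]
    (μ : Ω → ℝ) (X : Ω → A) (g : A → ℝ) :
    ∑ a, dist' μ X a * g a = ∑ ω, μ ω * g (X ω) := by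
  simp only [dist', Finset.sum_mul]
  rw [Finset.sum_comm]
  simp [ite_mul]

lemma entropy'_eq_sum {Ω A : Type*} [Fintype Ω] [Fintype A] [DecidableEq A]
    (μ : Ω → ℝ) (X : Ω → A) :
    entropy' μ X = -∑ ω, μ ω * Real.log (dist' μ X (X ω)) := by
  rw [entropy', sum_dist'_mul μ X fun a => Real.log (dist' μ X a)]

/-- Random variables that determine each other have the same entropy. -/
lemma entropy'_congr {Ω A B : Type*} [Fintype Ω] [Fintype A] [Fintype B]
    [DecidableEq A] [DecidableEq B] (μ : Ω → ℝ) (X : Ω → A) (Y : Ω → B)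
    (h : ∀ ω ω', X ω = X ω' ↔ Y ω = Y ω') : entropy' μ X = entropy' μ Y := by
  simp only [entropy'_eq_sum, dist', h]

lemma entropy'_const {Ω A : Type*} [Fintype Ω] [Fintype A] [DecidableEq A]
    (μ : Ω → ℝ) (hμ1 : ∑ ω, μ ω = 1) (a : A) : entropy' μ (fun _ => a) = 0 := by
  simp [entropy'_eq_sum, dist', hμ1]

lemma dist'_pos {Ω A : Type*} [Fintype Ω] [DecidableEq A] (μ : Ω → ℝ) (hμ0 : ∀ ω, 0 ≤ μ ω)
    (X : Ω → A) (ω : Ω) (hω : 0 < μ ω) : 0 < dist' μ X (X ω) := by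
  refine Finset.sum_pos' (fun i _ => ?_) ⟨ω, Finset.mem_univ ω, by simpa using hω⟩
  split_ifs
  exacts [hμ0 i, le_rfl]

lemma dist'_comp {Ω A B : Type*} [Fintype Ω] [Fintype A] [DecidableEq A] [DecidableEq B]
    (μ : Ω → ℝ) (X : Ω → A) (f : A → B) (b : B) :
    dist' μ (fun ω => f (X ω)) b = ∑ a, if f a = b then dist' μ X a else 0 := by
  have h := sum_dist'_mul μ X fun a => if f a = b then 1 else 0
  simp only [mul_ite, mul_one, mul_zero] at h
  rw [h, dist']

/-- Summing out the first variable of a pair. -/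
lemma sum_dist'_prod {Ω A B : Type*} [Fintype Ω] [Fintype A] [DecidableEq A] [DecidableEq B]
    (μ : Ω → ℝ) (X : Ω → A) (Y : Ω → B) (b : B) :
    ∑ a, dist' μ (fun ω => (X ω, Y ω)) (a, b) = dist' μ Y b := by
  simp only [dist', Prod.mk.injEq]
  rw [Finset.sum_comm]
  simp [ite_and]

/-- `N` is uniformly distributed and independent of `W`. -/
def UnifIndep {Ω G B : Type*} [Fintype Ω] [Fintype G] [DecidableEq G] [DecidableEq B]
    (μ : Ω → ℝ) (N : Ω → G) (W : Ω → B) : Prop :=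
  ∀ n w, dist' μ (fun ω => (N ω, W ω)) (n, w) = dist' μ W w / Fintype.card G

namespace UnifIndep

variable {Ω G B C : Type*} [Fintype Ω] [Fintype G]
  [DecidableEq G] [DecidableEq B] [DecidableEq C] {μ : Ω → ℝ} {N : Ω → G} {W : Ω → B}

lemma comp [Fintype B] (h : UnifIndep μ N W) (f : B → C) : UnifIndep μ N (fun ω => f (W ω)) := by
  intro n c
  have h1 : dist' μ (fun ω => (N ω, f (W ω))) (n, c) =
      ∑ w, if f w = c then dist' μ (fun ω => (N ω, W ω)) (n, w) else 0 := by
    rw [dist'_comp μ (fun ω => (N ω, W ω)) (fun p => (p.1, f p.2)), Fintype.sum_prod_type_right]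
    simp [ite_and]
  rw [h1, dist'_comp μ W f, Finset.sum_div]
  refine Finset.sum_congr rfl fun w _ => ?_
  rw [h n w]
  split_ifs <;> simp

/-- A one-time pad: shifting a uniform `N` by a function of an independent `W` keeps it uniform
and independent of `W`. -/
lemma add_left [AddCommGroup G] (h : UnifIndep μ N W) (f : B → G) :
    UnifIndep μ (fun ω => f (W ω) + N ω) W := by
  intro n w
  rw [← h (n - f w) w]
  simp only [dist', Prod.mk.injEq]
  refine Finset.sum_congr rfl fun ω _ => if_congr ?_ rfl rfl
  constructor
  · rintro ⟨rfl, rfl⟩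
    simp
  · rintro ⟨hn, rfl⟩
    simp [hn]

lemma entropy'_prod [Fintype B] (h : UnifIndep μ N W) (hμ0 : ∀ ω, 0 ≤ μ ω) (hμ1 : ∑ ω, μ ω = 1) :
    entropy' μ (fun ω => (N ω, W ω)) = Real.log (Fintype.card G) + entropy' μ W := by
  have key : ∀ ω, μ ω * Real.log (dist' μ (fun ω => (N ω, W ω)) (N ω, W ω)) =
      μ ω * Real.log (dist' μ W (W ω)) - μ ω * Real.log (Fintype.card G) := by
    intro ω
    rcases (hμ0 ω).eq_or_lt with h0 | h0
    · simp [← h0]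
    · have : Nonempty G := ⟨N ω⟩
      rw [h, Real.log_div (dist'_pos μ hμ0 W ω h0).ne' (by simp), mul_sub]
  rw [entropy'_eq_sum, entropy'_eq_sum, Finset.sum_congr rfl fun ω _ => key ω,
    Finset.sum_sub_distrib, ← Finset.sum_mul, hμ1]
  ring

end UnifIndep

/-- Conditional independence of `X` and `Y` given `C`, in terms of entropies. -/
lemma entropy'_add_of_condIndep {Ω A B C : Type*} [Fintype Ω] [Fintype A] [Fintype B] [Fintype C]
    [DecidableEq A] [DecidableEq B] [DecidableEq C] (μ : Ω → ℝ) (hμ0 : ∀ ω, 0 ≤ μ ω)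
    (X : Ω → A) (Y : Ω → B) (W : Ω → C)
    (h : ∀ x y c, dist' μ W c ≠ 0 →
      dist' μ (fun ω => (X ω, Y ω, W ω)) (x, y, c) * dist' μ W c =
        dist' μ (fun ω => (X ω, W ω)) (x, c) * dist' μ (fun ω => (Y ω, W ω)) (y, c)) :
    entropy' μ (fun ω => (X ω, Y ω, W ω)) + entropy' μ W =
      entropy' μ (fun ω => (X ω, W ω)) + entropy' μ (fun ω => (Y ω, W ω)) := by
  simp only [entropy'_eq_sum]
  rw [← neg_add, ← neg_add, ← Finset.sum_add_distrib, ← Finset.sum_add_distrib]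
  congr 1
  refine Finset.sum_congr rfl fun ω _ => ?_
  rcases (hμ0 ω).eq_or_lt with h0 | h0
  · simp [← h0]
  · have hW := (dist'_pos μ hμ0 W ω h0).ne'
    rw [← mul_add, ← mul_add,
      ← Real.log_mul (dist'_pos μ hμ0 (fun ω => (X ω, Y ω, W ω)) ω h0).ne' hW,
      ← Real.log_mul (dist'_pos μ hμ0 (fun ω => (X ω, W ω)) ω h0).ne'
        (dist'_pos μ hμ0 (fun ω => (Y ω, W ω)) ω h0).ne', h _ _ _ hW]

/-- Virtual protocol for a conditionally independent two-way wiretap channel: with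
`X1' := 0`, `X1'' = X1`, `Y1'' = Y1 ⊕ Y1'`, `X2'' = X2 ⊕ X2'`, `Y2'' = Y2 ⊕ Y2'`,
`V1 := Y1'` and `V2 := 0` (a constant), one has
`I(V1;(X2,Y2,X1'',Y1'')|(X2',Y2')) − I((V1,V2);(Z,X1'',Y1'',X2'',Y2''))
   = I(Y1;X2|X1) − I(Y1;Z|X1)`
and `I(V2;(X1,Y1,X2'',Y2'')|(X1',Y1')) = 0`. -/
theorem virtual_protocol_secrecy {Ω X1t X2t Y1t Y2t Zt : Type*}
    [Fintype Ω] [Fintype X1t] [Fintype X2t] [Fintype Y1t] [Fintype Y2t] [Fintype Zt]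
    [AddCommGroup X1t] [AddCommGroup X2t] [AddCommGroup Y1t] [AddCommGroup Y2t]
    [DecidableEq X1t] [DecidableEq X2t] [DecidableEq Y1t] [DecidableEq Y2t] [DecidableEq Zt]
    (μ : Ω → ℝ) (hμ0 : ∀ ω, 0 ≤ μ ω) (hμ1 : ∑ ω, μ ω = 1)
    (X1 : Ω → X1t) (X2 : Ω → X2t) (Y1 : Ω → Y1t) (Y2 : Ω → Y2t) (Zv : Ω → Zt)
    (Y1' : Ω → Y1t) (X2' : Ω → X2t) (Y2' : Ω → Y2t)
    -- X1 and X2 are independent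
    (hX1X2 : ∀ (x1 : X1t) (x2 : X2t),
      dist' μ (fun ω => (X1 ω, X2 ω)) (x1, x2) = dist' μ X1 x1 * dist' μ X2 x2)
    -- Y1, Y2, Z are mutually conditionally independent given (X1, X2)
    (hCI : ∀ (y1 : Y1t) (y2 : Y2t) (z : Zt) (x1 : X1t) (x2 : X2t),
      dist' μ (fun ω => (Y1 ω, Y2 ω, Zv ω, X1 ω, X2 ω)) (y1, y2, z, x1, x2) *
          (dist' μ (fun ω => (X1 ω, X2 ω)) (x1, x2)) ^ 2 =
        dist' μ (fun ω => (Y1 ω, X1 ω, X2 ω)) (y1, x1, x2) *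
          dist' μ (fun ω => (Y2 ω, X1 ω, X2 ω)) (y2, x1, x2) *
          dist' μ (fun ω => (Zv ω, X1 ω, X2 ω)) (z, x1, x2))
    -- Y1' is uniform on 𝒴1
    (hY1'unif : ∀ a, dist' μ Y1' a = 1 / (Fintype.card Y1t : ℝ))
    -- (X2', Y2') is uniform on 𝒳2 × 𝒴2
    (hX2'Y2'unif : ∀ p : X2t × Y2t, dist' μ (fun ω => (X2' ω, Y2' ω)) p =
      1 / ((Fintype.card X2t : ℝ) * (Fintype.card Y2t : ℝ)))
    -- Y1', (X2', Y2') and (X1, X2, Y1, Y2, Z) are mutually independent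
    (hindep3 : ∀ (a : Y1t) (b : X2t × Y2t) (c : X1t × X2t × Y1t × Y2t × Zt),
      dist' μ (fun ω => (Y1' ω, (X2' ω, Y2' ω), (X1 ω, X2 ω, Y1 ω, Y2 ω, Zv ω)))
          (a, b, c) =
        dist' μ Y1' a * dist' μ (fun ω => (X2' ω, Y2' ω)) b *
          dist' μ (fun ω => (X1 ω, X2 ω, Y1 ω, Y2 ω, Zv ω)) c) :
    (cmi μ Y1' (fun ω => (X2 ω, Y2 ω, X1 ω, Y1 ω + Y1' ω))
        (fun ω => (X2' ω, Y2' ω)) -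
      mi μ (fun ω => (Y1' ω, ()))
        (fun ω => (Zv ω, X1 ω, Y1 ω + Y1' ω, X2 ω + X2' ω, Y2 ω + Y2' ω)) =
      cmi μ Y1 X2 X1 - cmi μ Y1 Zv X1) ∧
    cmi μ (fun _ => ()) (fun ω => (X1 ω, Y1 ω, X2 ω + X2' ω, Y2 ω + Y2' ω))
        (fun ω => ((0 : X1t), Y1' ω)) = 0 := by
  have hunif : ∀ (a : Y1t) (w : (X2t × Y2t) × X1t × X2t × Y1t × Y2t × Zt),
      dist' μ (fun ω => (Y1' ω, (X2' ω, Y2' ω), (X1 ω, X2 ω, Y1 ω, Y2 ω, Zv ω))) (a, w) =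
        1 / (Fintype.card Y1t : ℝ) * (1 / ((Fintype.card X2t : ℝ) * (Fintype.card Y2t : ℝ)) *
          dist' μ (fun ω => (X1 ω, X2 ω, Y1 ω, Y2 ω, Zv ω)) w.2) := by
    rintro a ⟨b, c⟩
    rw [hindep3, hY1'unif, hX2'Y2'unif, mul_assoc]
  have hAW : ∀ w : (X2t × Y2t) × X1t × X2t × Y1t × Y2t × Zt,
      dist' μ (fun ω => ((X2' ω, Y2' ω), (X1 ω, X2 ω, Y1 ω, Y2 ω, Zv ω))) w =
        1 / ((Fintype.card X2t : ℝ) * (Fintype.card Y2t : ℝ)) *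
          dist' μ (fun ω => (X1 ω, X2 ω, Y1 ω, Y2 ω, Zv ω)) w.2 := by
    intro w
    rw [← sum_dist'_prod μ Y1', Finset.sum_congr rfl fun a _ => hunif a w]
    simp
  have hA : UnifIndep μ (fun ω => (X2' ω, Y2' ω))
      (fun ω => (X1 ω, X2 ω, Y1 ω, Y2 ω, Zv ω)) := by
    intro b c
    rw [hAW, Fintype.card_prod, Nat.cast_mul]
    ring
  have hK : UnifIndep μ Y1'
      (fun ω => ((X2' ω, Y2' ω), (X1 ω, X2 ω, Y1 ω, Y2 ω, Zv ω))) := by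
    intro a w
    rw [hunif, hAW]
    ring
  have hU := hA.add_left fun w => (w.2.1, w.2.2.2.1)
  have hY := hK.add_left fun w => w.2.2.2.1
  have hCI2 : entropy' μ (fun ω => (Y1 ω, Y2 ω, X1 ω, X2 ω)) + entropy' μ (fun ω => (X1 ω, X2 ω)) =
      entropy' μ (fun ω => (Y1 ω, X1 ω, X2 ω)) + entropy' μ (fun ω => (Y2 ω, X1 ω, X2 ω)) := by
    refine entropy'_add_of_condIndep μ hμ0 Y1 Y2 (fun ω => (X1 ω, X2 ω)) ?_
    rintro y1 y2 ⟨x1, x2⟩ hne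
    have hsum := Finset.sum_congr (rfl : (Finset.univ : Finset Zt) = _)
      fun z _ => hCI y1 y2 z x1 x2
    rw [← Finset.sum_mul, ← Finset.mul_sum, sum_dist'_prod μ Zv (fun ω => (X1 ω, X2 ω))] at hsum
    have hmarg : ∑ z, dist' μ (fun ω => (Y1 ω, Y2 ω, Zv ω, X1 ω, X2 ω)) (y1, y2, z, x1, x2) =
        dist' μ (fun ω => (Y1 ω, Y2 ω, X1 ω, X2 ω)) (y1, y2, x1, x2) := by
      rw [← sum_dist'_prod μ Zv]
      refine Finset.sum_congr rfl fun z _ => Finset.sum_congr rfl fun ω _ => if_congr ?_ rfl rfl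
      simp only [Prod.mk.injEq]
      tauto
    rw [hmarg] at hsum
    refine mul_right_cancel₀ hne ?_
    linear_combination hsum
  constructor
  · have e1 := (hK.comp fun w => w.1).entropy'_prod hμ0 hμ1
    have e2 := (hY.comp fun w => (w.1, w.2.1, w.2.2.1, w.2.2.2.2.1)).entropy'_prod hμ0 hμ1
    have e2' := (hA.comp fun w => (w.1, w.2.1, w.2.2.2.1)).entropy'_prod hμ0 hμ1
    have e3 := (hK.comp fun w => (w.1, w.2.1, w.2.2.1, w.2.2.2.1, w.2.2.2.2.1)).entropy'_prod
      hμ0 hμ1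
    have e3' := (hA.comp fun w => (w.1, w.2.1, w.2.2.1, w.2.2.2.1)).entropy'_prod hμ0 hμ1
    have e4 := (hK.comp fun _ => ()).entropy'_prod hμ0 hμ1
    have e5 := (hY.comp fun w => ((w.2.2.1 + w.1.1, w.2.2.2.2.1 + w.1.2), w.2.2.2.2.2,
      w.2.1)).entropy'_prod hμ0 hμ1
    have e5' := (hU.comp fun w => (w.2.2.2.2, w.1)).entropy'_prod hμ0 hμ1
    have e6 := (hK.comp fun w => ((w.2.2.1 + w.1.1, w.2.2.2.2.1 + w.1.2), w.2.2.2.2.2,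
      w.2.1, w.2.2.2.1)).entropy'_prod hμ0 hμ1
    have e6' := (hU.comp fun w => (w.2.2.2.2, w.1, w.2.2.1)).entropy'_prod hμ0 hμ1
    rw [entropy'_const μ hμ1] at e4
    have c2 : entropy' μ (fun ω => ((X2 ω, Y2 ω, X1 ω, Y1 ω + Y1' ω), (X2' ω, Y2' ω))) =
        entropy' μ (fun ω => (Y1 ω + Y1' ω, (X2' ω, Y2' ω), X1 ω, X2 ω, Y2 ω)) :=
      entropy'_congr _ _ _ fun ω ω' => by grind
    have c3 : entropy' μ (fun ω =>
          (Y1' ω, (X2 ω, Y2 ω, X1 ω, Y1 ω + Y1' ω), (X2' ω, Y2' ω))) =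
        entropy' μ (fun ω => (Y1' ω, (X2' ω, Y2' ω), X1 ω, X2 ω, Y1 ω, Y2 ω)) :=
      entropy'_congr _ _ _ fun ω ω' => by grind
    have c5 : entropy' μ (fun ω =>
          (Zv ω, X1 ω, Y1 ω + Y1' ω, X2 ω + X2' ω, Y2 ω + Y2' ω)) =
        entropy' μ (fun ω => (Y1 ω + Y1' ω, (X2 ω + X2' ω, Y2 ω + Y2' ω), Zv ω, X1 ω)) :=
      entropy'_congr _ _ _ fun ω ω' => by grind
    have c6 : entropy' μ (fun ω =>
          ((Y1' ω, ()), (Zv ω, X1 ω, Y1 ω + Y1' ω, X2 ω + X2' ω, Y2 ω + Y2' ω))) =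
        entropy' μ (fun ω => (Y1' ω, (X2 ω + X2' ω, Y2 ω + Y2' ω), Zv ω, X1 ω, Y1 ω)) :=
      entropy'_congr _ _ _ fun ω ω' => by grind
    have d1 : entropy' μ (fun ω => (Y1 ω, Y2 ω, X1 ω, X2 ω)) =
        entropy' μ (fun ω => (X1 ω, X2 ω, Y1 ω, Y2 ω)) :=
      entropy'_congr _ _ _ fun ω ω' => by grind
    have d2 : entropy' μ (fun ω => (Y2 ω, X1 ω, X2 ω)) =
        entropy' μ (fun ω => (X1 ω, X2 ω, Y2 ω)) :=
      entropy'_congr _ _ _ fun ω ω' => by grind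
    have d3 : entropy' μ (fun ω => (Y1 ω, X2 ω, X1 ω)) =
        entropy' μ (fun ω => (Y1 ω, X1 ω, X2 ω)) :=
      entropy'_congr _ _ _ fun ω ω' => by grind
    have d4 : entropy' μ (fun ω => (Y1 ω, Zv ω, X1 ω)) =
        entropy' μ (fun ω => (Zv ω, X1 ω, Y1 ω)) :=
      entropy'_congr _ _ _ fun ω ω' => by grind
    have d5 : entropy' μ (fun ω => (X2 ω, X1 ω)) = entropy' μ (fun ω => (X1 ω, X2 ω)) :=
      entropy'_congr _ _ _ fun ω ω' => by grind
    simp only [cmi, mi, Prod.mk_add_mk] at *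
    linarith
  · rw [cmi, entropy'_congr μ (fun ω => ((), (0 : X1t), Y1' ω)) (fun ω => ((0 : X1t), Y1' ω))
        fun ω ω' => by simp,
      entropy'_congr μ
        (fun ω => ((), (X1 ω, Y1 ω, X2 ω + X2' ω, Y2 ω + Y2' ω), (0 : X1t), Y1' ω))
        (fun ω => ((X1 ω, Y1 ω, X2 ω + X2' ω, Y2 ω + Y2' ω), (0 : X1t), Y1' ω))
        fun ω ω' => by simp]
    ring

end
end

section
/- For the additive two-way wiretap channel, I(Z ; X_1) = 0, I(Z ; X_2) = 0, and I((X_1,X_2) ; Z) = log q − H(N_3). -/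
open Finset

noncomputable section

section Aux

variable {Ω A B C : Type*} [Fintype Ω] [DecidableEq A] [DecidableEq B] [DecidableEq C]

theorem dist'_eq_of_iff {μ : Ω → ℝ} {X : Ω → A} {Y : Ω → B} {a : A} {b : B}
    (h : ∀ ω, X ω = a ↔ Y ω = b) : dist' μ X a = dist' μ Y b := by
  simp only [dist', h]

theorem sum_dist' [Fintype A] (μ : Ω → ℝ) (X : Ω → A) : ∑ a, dist' μ X a = ∑ ω, μ ω := by
  simp only [dist']
  rw [sum_comm]
  simp

theorem sum_dist'_prodMk [Fintype B] (μ : Ω → ℝ) (X : Ω → A) (Y : Ω → B) (a : A) :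
    ∑ b, dist' μ (fun ω => (X ω, Y ω)) (a, b) = dist' μ X a := by
  simp only [dist']
  rw [sum_comm]
  simp [Prod.ext_iff, ite_and]

/-- Two random variables on `(Ω, μ)` are independent: their joint distribution is the product
of the marginals. -/
def IndepPair (μ : Ω → ℝ) (X : Ω → A) (Y : Ω → B) : Prop :=
  ∀ a b, dist' μ (fun ω => (X ω, Y ω)) (a, b) = dist' μ X a * dist' μ Y b

theorem IndepPair.fst_right [Fintype C] {μ : Ω → ℝ} {X : Ω → A} {Y : Ω → B} {W : Ω → C}
    (h : IndepPair μ X (fun ω => (Y ω, W ω))) : IndepPair μ X Y := by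
  intro a b
  rw [← sum_dist'_prodMk μ _ W, ← sum_dist'_prodMk μ Y W, mul_sum]
  refine sum_congr rfl fun c _ => ?_
  rw [← h a (b, c)]
  exact dist'_eq_of_iff fun ω => by simp only [Prod.ext_iff, and_assoc]

theorem entropy'_congr_equiv [Fintype A] [Fintype B] (μ : Ω → ℝ) {X : Ω → A} {Y : Ω → B}
    (e : A ≃ B) (h : ∀ ω, e (X ω) = Y ω) : entropy' μ X = entropy' μ Y := by
  have hd : ∀ a, dist' μ X a = dist' μ Y (e a) := fun a =>
    dist'_eq_of_iff fun ω => by rw [← h, e.apply_eq_iff_eq]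
  simp only [entropy', hd]
  rw [e.sum_comp fun b => dist' μ Y b * Real.log (dist' μ Y b)]

theorem IndepPair.entropy'_prodMk [Fintype A] [Fintype B] {μ : Ω → ℝ} (hμ : ∑ ω, μ ω = 1)
    {X : Ω → A} {Y : Ω → B} (h : IndepPair μ X Y) :
    entropy' μ (fun ω => (X ω, Y ω)) = entropy' μ X + entropy' μ Y := by
  have hlog : ∀ x y : ℝ, x * y * Real.log (x * y) =
      x * Real.log x * y + x * (y * Real.log y) := by
    intro x y
    rcases eq_or_ne x 0 with rfl | hx
    · simp
    rcases eq_or_ne y 0 with rfl | hy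
    · simp
    rw [Real.log_mul hx hy]
    ring
  simp only [entropy', Fintype.sum_prod_type, h _ _, hlog, sum_add_distrib, ← mul_sum, ← sum_mul,
    sum_dist', hμ]
  ring

theorem IndepPair.mi_eq_zero [Fintype A] [Fintype B] {μ : Ω → ℝ} (hμ : ∑ ω, μ ω = 1)
    {X : Ω → A} {Y : Ω → B} (h : IndepPair μ X Y) : mi μ X Y = 0 := by
  rw [mi, h.entropy'_prodMk hμ, sub_self]

theorem entropy'_of_uniform [Fintype A] [Nonempty A] {μ : Ω → ℝ} {X : Ω → A}
    (h : ∀ a, dist' μ X a = 1 / (Fintype.card A : ℝ)) :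
    entropy' μ X = Real.log (Fintype.card A : ℝ) := by
  have hA : (Fintype.card A : ℝ) ≠ 0 := by simp
  simp [entropy', h, hA]

variable {F : Type*} [Field F] [Fintype F] [DecidableEq F]

theorem IndepPair.dist'_mul_add_prodMk {μ : Ω → ℝ} {X : Ω → F} {Y : Ω → B}
    (h : IndepPair μ X Y) (hX : ∀ x, dist' μ X x = 1 / (Fintype.card F : ℝ)) {c : F} (hc : c ≠ 0)
    (g : B → F) (z : F) (b : B) :
    dist' μ (fun ω => (c * X ω + g (Y ω), Y ω)) (z, b) =
      1 / (Fintype.card F : ℝ) * dist' μ Y b := by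
  rw [← hX (c⁻¹ * (z - g b)), ← h]
  refine dist'_eq_of_iff fun ω => ?_
  simp only [Prod.ext_iff]
  refine and_congr_left fun hb => ?_
  rw [hb, eq_inv_mul_iff_mul_eq₀ hc, eq_sub_iff_add_eq]

theorem IndepPair.dist'_mul_add [Fintype B] {μ : Ω → ℝ} (hμ : ∑ ω, μ ω = 1) {X : Ω → F}
    {Y : Ω → B} (h : IndepPair μ X Y) (hX : ∀ x, dist' μ X x = 1 / (Fintype.card F : ℝ))
    {c : F} (hc : c ≠ 0) (g : B → F) (z : F) :
    dist' μ (fun ω => c * X ω + g (Y ω)) z = 1 / (Fintype.card F : ℝ) := by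
  rw [← sum_dist'_prodMk μ _ Y]
  simp only [h.dist'_mul_add_prodMk hX hc g, ← mul_sum, sum_dist', hμ, mul_one]

/-- Adding a function of `Y` to an independent uniform variable keeps it independent of `Y`. -/
theorem IndepPair.mul_add [Fintype B] {μ : Ω → ℝ} (hμ : ∑ ω, μ ω = 1) {X : Ω → F}
    {Y : Ω → B} (h : IndepPair μ X Y) (hX : ∀ x, dist' μ X x = 1 / (Fintype.card F : ℝ))
    {c : F} (hc : c ≠ 0) (g : B → F) :
    IndepPair μ (fun ω => c * X ω + g (Y ω)) Y := fun z b => by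
  rw [h.dist'_mul_add_prodMk hX hc g, h.dist'_mul_add hμ hX hc g]

end Aux

/-- For the additive two-way wiretap channel, `I(Z;X1) = 0`, `I(Z;X2) = 0` and `I((X1,X2);Z) = log q − H(N3)`. -/
theorem additive_mi_Z {Ω F : Type*} [Fintype Ω] [Field F] [Fintype F] [DecidableEq F]
    (μ : Ω → ℝ) (hμ0 : ∀ ω, 0 ≤ μ ω) (hμ1 : ∑ ω, μ ω = 1)
    (a1 b1 a2 b2 a3 b3 : F)
    (ha1 : a1 ≠ 0) (hb1 : b1 ≠ 0) (ha2 : a2 ≠ 0)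
    (hb2 : b2 ≠ 0) (ha3 : a3 ≠ 0) (hb3 : b3 ≠ 0)
    (X1 X2 N1 N2 N3 : Ω → F)
    (hX1unif : ∀ x, dist' μ X1 x = 1 / (Fintype.card F : ℝ))
    (hX2unif : ∀ x, dist' μ X2 x = 1 / (Fintype.card F : ℝ))
    (hindep : ∀ x1 x2 n1 n2 n3,
      dist' μ (fun ω => (X1 ω, X2 ω, N1 ω, N2 ω, N3 ω)) (x1, x2, n1, n2, n3) =
        dist' μ X1 x1 * dist' μ X2 x2 * dist' μ N1 n1 * dist' μ N2 n2 * dist' μ N3 n3) :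
    mi μ (fun ω => a3 * X1 ω + b3 * X2 ω + N3 ω) X1 = 0 ∧
    mi μ (fun ω => a3 * X1 ω + b3 * X2 ω + N3 ω) X2 = 0 ∧
    mi μ (fun ω => (X1 ω, X2 ω)) (fun ω => a3 * X1 ω + b3 * X2 ω + N3 ω) =
      Real.log (Fintype.card F : ℝ) - entropy' μ N3 := by
  have htriple : ∀ x1 x2 n3, dist' μ (fun ω => (X1 ω, X2 ω, N3 ω)) (x1, x2, n3) =
      dist' μ X1 x1 * dist' μ X2 x2 * dist' μ N3 n3 := by
    intro x1 x2 n3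
    have h5 : ∀ n1 n2, dist' μ (fun ω => ((X1 ω, X2 ω, N3 ω), N1 ω, N2 ω))
        ((x1, x2, n3), n1, n2) = dist' μ X1 x1 * dist' μ X2 x2 * dist' μ N3 n3 *
          (dist' μ N1 n1 * dist' μ N2 n2) := by
      intro n1 n2
      rw [dist'_eq_of_iff (Y := fun ω => (X1 ω, X2 ω, N1 ω, N2 ω, N3 ω))
        (b := (x1, x2, n1, n2, n3)) fun ω => by simp only [Prod.ext_iff]; tauto, hindep]
      ring
    rw [← sum_dist'_prodMk μ _ (fun ω => (N1 ω, N2 ω)), Fintype.sum_prod_type]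
    simp only [h5, ← mul_sum, sum_dist', hμ1, mul_one]
  have hX1N3 : ∀ x n, dist' μ (fun ω => (X1 ω, N3 ω)) (x, n) = dist' μ X1 x * dist' μ N3 n := by
    intro x n
    have h3 : ∀ x2, dist' μ (fun ω => ((X1 ω, N3 ω), X2 ω)) ((x, n), x2) =
        dist' μ X1 x * dist' μ N3 n * dist' μ X2 x2 := by
      intro x2
      rw [dist'_eq_of_iff (Y := fun ω => (X1 ω, X2 ω, N3 ω)) (b := (x, x2, n)) fun ω => by
        simp only [Prod.ext_iff]; tauto, htriple]
      ring
    rw [← sum_dist'_prodMk μ _ X2]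
    simp only [h3, ← mul_sum, sum_dist', hμ1, mul_one]
  have hX2N3 : ∀ x n, dist' μ (fun ω => (X2 ω, N3 ω)) (x, n) = dist' μ X2 x * dist' μ N3 n := by
    intro x n
    have h3 : ∀ x1, dist' μ (fun ω => ((X2 ω, N3 ω), X1 ω)) ((x, n), x1) =
        dist' μ X2 x * dist' μ N3 n * dist' μ X1 x1 := by
      intro x1
      rw [dist'_eq_of_iff (Y := fun ω => (X1 ω, X2 ω, N3 ω)) (b := (x1, x, n)) fun ω => by
        simp only [Prod.ext_iff]; tauto, htriple]
      ring
    rw [← sum_dist'_prodMk μ _ X1]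
    simp only [h3, ← mul_sum, sum_dist', hμ1, mul_one]
  have hind1 : IndepPair μ X1 (fun ω => (X2 ω, N3 ω)) := by
    rintro x1 ⟨x2, n⟩
    rw [htriple, hX2N3, mul_assoc]
  have hind2 : IndepPair μ X2 (fun ω => (X1 ω, N3 ω)) := by
    rintro x2 ⟨x1, n⟩
    rw [dist'_eq_of_iff (Y := fun ω => (X1 ω, X2 ω, N3 ω)) (b := (x1, x2, n)) fun ω => by
      simp only [Prod.ext_iff]; tauto, htriple, hX1N3]
    ring
  have hind12 : IndepPair μ X1 X2 := hind1.fst_right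
  have hind3 : IndepPair μ (fun ω => (X1 ω, X2 ω)) N3 := by
    rintro ⟨x1, x2⟩ n
    rw [dist'_eq_of_iff (Y := fun ω => (X1 ω, X2 ω, N3 ω)) (b := (x1, x2, n)) fun ω => by
      simp only [Prod.ext_iff]; tauto, htriple, hind12]
  have hZ1 : (fun ω => a3 * X1 ω + b3 * X2 ω + N3 ω) =
      fun ω => a3 * X1 ω + (b3 * X2 ω + N3 ω) := by
    funext ω
    ring
  have hZ2 : (fun ω => a3 * X1 ω + b3 * X2 ω + N3 ω) =
      fun ω => b3 * X2 ω + (a3 * X1 ω + N3 ω) := by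
    funext ω
    ring
  refine ⟨?_, ?_, ?_⟩
  · rw [hZ2]
    exact (hind2.mul_add hμ1 hX2unif hb3 fun y => a3 * y.1 + y.2).fst_right.mi_eq_zero hμ1
  · rw [hZ1]
    exact (hind1.mul_add hμ1 hX1unif ha3 fun y => b3 * y.1 + y.2).fst_right.mi_eq_zero hμ1
  · have hHZ : entropy' μ (fun ω => a3 * X1 ω + b3 * X2 ω + N3 ω) =
        Real.log (Fintype.card F : ℝ) := by
      rw [hZ1]
      exact entropy'_of_uniform
        (hind1.dist'_mul_add hμ1 hX1unif ha3 fun y => b3 * y.1 + y.2)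
    have hjoint : entropy' μ (fun ω => ((X1 ω, X2 ω), N3 ω)) =
        entropy' μ (fun ω => ((X1 ω, X2 ω), a3 * X1 ω + b3 * X2 ω + N3 ω)) :=
      entropy'_congr_equiv μ
        (Equiv.prodShear (Equiv.refl (F × F)) fun x => Equiv.addLeft (a3 * x.1 + b3 * x.2))
        fun ω => rfl
    rw [mi, hHZ, ← hjoint, hind3.entropy'_prodMk hμ1]
    ring

end
end

section
/- Fourier–Motzkin elimination for the joint-secrecy rate region (completeness): Let a, b, c1, c2, c12 be real numbers with 0 ≤ c1 < a, 0 ≤ c2 < b, and c1 + c2 ≤ c12. Suppose R_1, R_2 ≥ 0 satisfy R_1 < a, R_2 < b, and R_1 + R_2 < a + b − c12. Then there exist nonnegative reals R_{1,s}, R_{1,k}, R_{1,o}, R_{1,e}, R_{2,s}, R_{2,k}, R_{2,o}, R_{2,e} with R_1 = R_{1,s}+R_{1,e} and R_2 = R_{2,s}+R_{2,e} satisfying: R_{1,s}+R_{1,k}+R_{1,o}+R_{1,e} < a; R_{2,s}+R_{2,k}+R_{2,o}+R_{2,e} < b; R_{1,e} ≤ R_{2,k}; R_{2,e} ≤ R_{1,k};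 R_{1,o}+R_{1,e} > c1; R_{2,o}+R_{2,e} > c2; R_{1,o}+R_{1,e}+R_{2,o}+R_{2,e} > c12. -/
/-- Encrypted rates `x`, `y` of the two users (each protected by the other user's key) that leave
room for enough randomness at both users. -/
lemma exists_encrypted_rates {a b c1 c2 R1 R2 : ℝ}
    (hc1 : 0 ≤ c1) (hc1a : c1 < a) (hc2 : 0 ≤ c2) (hc2b : c2 < b)
    (hR1 : 0 ≤ R1) (hR2 : 0 ≤ R2) (h1 : R1 < a) (h2 : R2 < b)
    (h12 : R1 + R2 < a + b - (c1 + c2)) :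
    ∃ x y : ℝ, 0 ≤ x ∧ x ≤ R1 ∧ 0 ≤ y ∧ y ≤ R2 ∧ R1 + y < a ∧ R2 + x < b ∧
      c1 < a - R1 - y + x ∧ c2 < b - R2 - x + y := by
  by_cases hL : c1 - (a - R1) < 0
  · by_cases hU : 0 < b - R2 - c2
    · exact ⟨0, 0, by grind⟩
    · obtain ⟨y, hy, hy'⟩ := exists_between
        (show c2 - (b - R2) < min R2 (a - R1 - c1) from lt_min (by linarith) (by linarith))
      obtain ⟨hyR, hya⟩ := lt_min_iff.mp hy'
      refine ⟨0, y, ?_, ?_, ?_, ?_, ?_, ?_, ?_, ?_⟩ <;> linarith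
  · obtain ⟨x, hx, hx'⟩ := exists_between
      (show c1 - (a - R1) < min R1 (b - R2 - c2) from lt_min (by linarith) (by linarith))
    obtain ⟨hxR, hxb⟩ := lt_min_iff.mp hx'
    refine ⟨x, 0, ?_, ?_, ?_, ?_, ?_, ?_, ?_, ?_⟩ <;> linarith

/-- Fourier–Motzkin elimination for the joint-secrecy rate region (completeness). -/
theorem fm_joint_complete (a b c1 c2 c12 : ℝ)
    (hc1 : 0 ≤ c1) (hc1a : c1 < a) (hc2 : 0 ≤ c2) (hc2b : c2 < b)
    (hc12 : c1 + c2 ≤ c12)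
    (R1 R2 : ℝ) (hR1 : 0 ≤ R1) (hR2 : 0 ≤ R2)
    (h1 : R1 < a) (h2 : R2 < b) (h12 : R1 + R2 < a + b - c12) :
    ∃ R1s R1k R1o R1e R2s R2k R2o R2e : ℝ,
      0 ≤ R1s ∧ 0 ≤ R1k ∧ 0 ≤ R1o ∧ 0 ≤ R1e ∧
      0 ≤ R2s ∧ 0 ≤ R2k ∧ 0 ≤ R2o ∧ 0 ≤ R2e ∧
      R1 = R1s + R1e ∧ R2 = R2s + R2e ∧
      R1s + R1k + R1o + R1e < a ∧
      R2s + R2k + R2o + R2e < b ∧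
      R1e ≤ R2k ∧ R2e ≤ R1k ∧
      c1 < R1o + R1e ∧ c2 < R2o + R2e ∧
      c12 < R1o + R1e + R2o + R2e := by
  obtain ⟨x, y, hx, hxR, hy, hyR, hya, hxb, hx1, hy2⟩ :=
    exists_encrypted_rates hc1 hc1a hc2 hc2b hR1 hR2 h1 h2 (by linarith)
  obtain ⟨ε, hε, hε'⟩ := exists_between
    (show 0 < min (min (a - R1 - y) (b - R2 - x)) (min (min (a - R1 - y + x - c1)
      (b - R2 - x + y - c2)) ((a + b - R1 - R2 - c12) / 2)) by
      refine lt_min (lt_min ?_ ?_) (lt_min (lt_min ?_ ?_) ?_) <;> linarith)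
  simp only [lt_min_iff] at hε'
  obtain ⟨⟨e1, e2⟩, ⟨e3, e4⟩, e5⟩ := hε'
  refine ⟨R1 - x, y, a - R1 - y - ε, x, R2 - y, x, b - R2 - x - ε, y,
    ?_, ?_, ?_, ?_, ?_, ?_, ?_, ?_, ?_, ?_, ?_, ?_, ?_, ?_, ?_, ?_, ?_⟩ <;> linarith
end

section
/- Fourier–Motzkin elimination for the individual-secrecy rate region (soundness): Let a, b, c1, c2, c12 be real numbers and let R_{1,s}, R_{1,k}, R_{1,o}, R_{1,e}, R_{2,s}, R_{2,k}, R_{2,o}, R_{2,e} be nonnegative reals satisfying: R_{1,s}+R_{1,k}+R_{1,o}+R_{1,e} < a; R_{2,s}+R_{2,k}+R_{2,o}+R_{2,e} < b; R_{1,e} ≤ R_{2,k}; R_{2,e} ≤ R_{1,k}; R_{1,o}+R_{1,e} > c1; R_{2,o}+R_{2,e} > c2; R_{1,o}+R_{1,e}+R_{2,o}+R_{2,e} + min(R_{1,s}, R_{2,s}) > c12. Then R_1 := R_{1,s}+R_{1,e} and R_2 := R_{2,s}+R_{2,e} satisfy R_1 < a, R_2 < b, max(R_1, R_2) < a + b −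 c12, and R_1 + R_2 < min(a − c1, a + b − c12) + min(b − c2, a + b − c12). -/
/-- Fourier–Motzkin elimination for the individual-secrecy rate region (soundness). -/
theorem fm_individual_sound (a b c1 c2 c12 : ℝ)
    (R1s R1k R1o R1e R2s R2k R2o R2e : ℝ)
    (hR1s : 0 ≤ R1s) (hR1k : 0 ≤ R1k) (hR1o : 0 ≤ R1o) (hR1e : 0 ≤ R1e)
    (hR2s : 0 ≤ R2s) (hR2k : 0 ≤ R2k) (hR2o : 0 ≤ R2o) (hR2e : 0 ≤ R2e)
    (h1 : R1s + R1k + R1o + R1e < a)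
    (h2 : R2s + R2k + R2o + R2e < b)
    (h3 : R1e ≤ R2k) (h4 : R2e ≤ R1k)
    (h5 : c1 < R1o + R1e) (h6 : c2 < R2o + R2e)
    (h7 : c12 < R1o + R1e + R2o + R2e + min R1s R2s) :
    R1s + R1e < a ∧ R2s + R2e < b ∧
    max (R1s + R1e) (R2s + R2e) < a + b - c12 ∧
    (R1s + R1e) + (R2s + R2e) <
      min (a - c1) (a + b - c12) + min (b - c2) (a + b - c12) := by
  have hmin₁ := min_le_left R1s R2s
  have hmin₂ := min_le_right R1s R2s
  refine ⟨by linarith, by linarith, max_lt (by linarith) (by linarith), ?_⟩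
  rcases min_choice (a - c1) (a + b - c12) with h | h <;>
    rcases min_choice (b - c2) (a + b - c12) with h' | h' <;>
    rw [h, h'] <;> linarith
end
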